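/- Let n be a sufficiently large integer, G̃ a tripartite graph with parts A, B, C where |A| = |C| = n and |B| = ⌊n/3⌋, with A–B adjacency matrix P̃ and B–C adjacency matrix Q, and write Γ(a) = {b ∈ B : P̃_{a,b} = 1}. Let W be a correct witness for P̃ × Q, and suppose that for each a ∈ A there are distinct subintervals K_{a,1}, …, K_{a,ℓ_a} ⊆ C with C = ∪_{j∈[ℓ_a]} K_{a,j} and union gates g_{a,1}, …, g_{a,ℓ_a} in W such that g_{a,j} outputs (Γ(a), K_{a,j}, v_{a,j}) for some vector v_{a,j}. Let c, d ≥ 4 be integers, let ℓ ≥ 1 and let r ≥ 2d·log₂ n be integers, and let L = {a ∈ A : ℓ_a ≥ ℓ and |Γ(a)| ≥ r}. If the bipartite graph between A and B in G̃ is (c·log₂ n, d·log₂ n)-diverse, then the number of gates of W is at least r·ℓ·|L| / (2cd·(log₂ n)²). -/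

import Mathlib

open scoped Classical

/-- The kind of a gate in a witness circuit: an input gate assigned some `b ∈ B`; a
partition gate with its predecessor and an assigned subinterval `K'` (given by its start
and length in `C`); a union gate with its two predecessors; or a concatenation gate with
its two predecessors. -/
inductive Gk (nB N : ℕ) where
  | input : Fin nB → Gk nB N
  | partition : Fin N → ℕ → ℕ → Gk nB N
  | union : Fin N → Fin N → Gk nB N
  | concat : Fin N → Fin N → Gk nB N

/-- The predecessors of a gate of the given kind. -/
def Gk.preds {nB N : ℕ} : Gk nB N → List (Fin N)
  | .input _ => []
  | .partition p _ _ => [p]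
  | .union l r => [l, r]
  | .concat l r => [l, r]

/-- A witness circuit over `B = Fin nB`: a finite DAG of gates (indexed by `Fin N`,
predecessors of a gate having smaller index).  Each gate `g` outputs a triple
`(S, K, v)`, where `S = wset g ⊆ B` indexes a set of rows of `Q`, `K` is the subinterval
of `C` consisting of the `ln g` columns starting at `st g`, and
`v = row(Q_S)|_K` is determined by `(S, K)`. -/
structure WitnessCircuit (nB : ℕ) where
  N : ℕ
  kind : Fin N → Gk nB N
  wset : Fin N → Finset (Fin nB)
  st : Fin N → ℕ
  ln : Fin N → ℕ
  hacyc : ∀ g : Fin N, ∀ h ∈ (kind g).preds, h < g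

/-- Every gate's output is defined, with `C = Fin nC`: input gates output `({b}, C, Q_b)`;
a partition gate with assigned subinterval `K'` requires `K' ⊆ K` and restricts to `K'`;
a union gate requires its two inputs to carry the same subinterval and outputs the union of
the row sets; a concatenation gate requires the same row set on both sides, with
`min K_L ≤ min K_R`, `max K_L + 1 ≥ min K_R` and `max K_L ≤ max K_R`, and outputs
`(S, K_L ∪ K_R, ·)`. -/
def WitnessCircuit.Defined {nB : ℕ} (nC : ℕ) (W : WitnessCircuit nB) : Prop :=
  (∀ g, 1 ≤ W.ln g ∧ W.st g + W.ln g ≤ nC) ∧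
  ∀ g, match W.kind g with
    | .input b => W.wset g = {b} ∧ W.st g = 0 ∧ W.ln g = nC
    | .partition p s l => 1 ≤ l ∧ W.st p ≤ s ∧ s + l ≤ W.st p + W.ln p ∧
        W.wset g = W.wset p ∧ W.st g = s ∧ W.ln g = l
    | .union l r => W.st l = W.st r ∧ W.ln l = W.ln r ∧
        W.wset g = W.wset l ∪ W.wset r ∧ W.st g = W.st l ∧ W.ln g = W.ln l
    | .concat l r => W.wset l = W.wset r ∧
        W.st l ≤ W.st r ∧ W.st r ≤ W.st l + W.ln l ∧
        W.st l + W.ln l ≤ W.st r + W.ln r ∧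
        W.wset g = W.wset l ∧ W.st g = W.st l ∧
        W.st g + W.ln g = W.st r + W.ln r

/-- The circuit is structured: union gates do not send values into partition gates, and
concatenation gates do not send values into partition or union gates. -/
def WitnessCircuit.Structured {nB : ℕ} (W : WitnessCircuit nB) : Prop :=
  ∀ g, match W.kind g with
    | .input _ => True
    | .partition p _ _ => ∀ x y : Fin W.N,
        W.kind p ≠ Gk.union x y ∧ W.kind p ≠ Gk.concat x y
    | .union l r => ∀ x y : Fin W.N,
        W.kind l ≠ Gk.concat x y ∧ W.kind r ≠ Gk.concat x y
    | .concat _ _ => True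

/-- A correct witness for `P × Q`: a structured witness circuit, all of whose gates are
defined, such that for every `a ∈ A` some gate outputs `(Γ(a), C, row(Q_{Γ(a)}))`, where
`Γ(a) = {b ∈ B : P a b = 1}`. -/
def WitnessCircuit.Correct {nA nB : ℕ} (nC : ℕ) (P : Fin nA → Fin nB → Bool)
    (W : WitnessCircuit nB) : Prop :=
  W.Defined nC ∧ W.Structured ∧
  ∀ a : Fin nA, ∃ g, W.wset g = (Finset.univ.filter fun b => P a b = true) ∧
    W.st g = 0 ∧ W.ln g = nC

/-- A bipartite graph (adjacency matrix `P'`) between `A = Fin nA` and `B = Fin nB` is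
`(k,ℓ)`-diverse if for every `S ⊆ B` with `|S| ≥ ℓ`, fewer than `k` vertices of `A` are
adjacent to every vertex of `S`. -/
def Diverse {nA nB : ℕ} (P' : Fin nA → Fin nB → Bool) (k l : ℝ) : Prop :=
  ∀ S : Finset (Fin nB), l ≤ (S.card : ℝ) →
    ((Finset.univ.filter fun a : Fin nA => ∀ b ∈ S, P' a b = true).card : ℝ) < k

/-- A gate that is neither a union nor a concatenation gate carries a single row. -/
theorem WitnessCircuit.card_wset_eq_one {nB nC : ℕ} {W : WitnessCircuit nB}
    (hD : W.Defined nC) (hS : W.Structured) (g : Fin W.N)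
    (hu : ∀ x y, W.kind g ≠ Gk.union x y) (hc : ∀ x y, W.kind g ≠ Gk.concat x y) :
    (W.wset g).card = 1 := by
  induction g using WellFoundedLT.induction with
  | ind g ih =>
    have hd := hD.2 g
    have hs := hS g
    have hlt := W.hacyc g
    cases hk : W.kind g with
    | input b =>
      simp only [hk] at hd
      simp [hd.1]
    | partition p s k =>
      simp only [hk] at hd hs
      rw [hd.2.2.2.1]
      exact ih p (hlt p (by simp [hk, Gk.preds])) (fun x y => (hs x y).1) fun x y => (hs x y).2
    | union x y => exact absurd hk (hu x y)
    | concat x y => exact absurd hk (hc x y)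

/-- The gates on the interval `[s, s + k)` whose row set has at least `D` elements and is
contained in `S`. -/
noncomputable def WitnessCircuit.largeGates {nB : ℕ} (W : WitnessCircuit nB)
    (D : ℝ) (s k : ℕ) (S : Finset (Fin nB)) : Finset (Fin W.N) :=
  Finset.univ.filter fun h =>
    (W.st h = s ∧ W.ln h = k) ∧ D ≤ ((W.wset h).card : ℝ) ∧ W.wset h ⊆ S

theorem WitnessCircuit.card_biUnion_wset_le {nB nC : ℕ} {W : WitnessCircuit nB}
    (hD : W.Defined nC) (hS : W.Structured) {D : ℝ} (h1 : 1 < D) (s k : ℕ)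
    (S : Finset (Fin nB)) (m : ℕ) (X : Finset (Fin W.N)) (hXm : ∀ g ∈ X, g.val < m)
    (hX : ∀ g ∈ X, (W.st g = s ∧ W.ln g = k) ∧ W.wset g ⊆ S ∧
      ∀ x y, W.kind g ≠ Gk.concat x y) :
    ((X.biUnion W.wset).card : ℝ) ≤
      D * (X.card + ((W.largeGates D s k S).filter fun h => h.val < m).card) := by
  induction m generalizing X with
  | zero =>
    obtain rfl : X = ∅ := Finset.eq_empty_of_forall_notMem fun g hg => absurd (hXm g hg) (by simp)
    simp only [Finset.biUnion_empty, Finset.card_empty, Nat.cast_zero]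
    positivity
  | succ m ih =>
    have hmono : (((W.largeGates D s k S).filter fun h => h.val < m).card : ℝ) ≤
        ((W.largeGates D s k S).filter fun h => h.val < m + 1).card := by
      exact_mod_cast Finset.card_le_card
        (Finset.monotone_filter_right _ fun h _ hh => Nat.lt_succ_of_lt hh)
    by_cases hmX : ∃ g ∈ X, g.val = m
    · obtain ⟨g, hgX, hgm⟩ := hmX
      have hne : ∀ h ∈ X.erase g, h.val < m := fun h hh => by
        have h2 := hXm h (Finset.mem_of_mem_erase hh)
        have h3 : h.val ≠ g.val := fun e => Finset.ne_of_mem_erase hh (Fin.ext e)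
        omega
      have hXi : insert g (X.erase g) = X := Finset.insert_erase hgX
      have hcard : ((X.erase g).card : ℝ) + 1 = X.card := by
        exact_mod_cast Finset.card_erase_add_one hgX
      obtain ⟨hgK, hgS, hgc⟩ := hX g hgX
      by_cases hlarge : D ≤ ((W.wset g).card : ℝ)
      · have hun : ∃ x y, W.kind g = Gk.union x y := by
          by_contra! hno
          rw [W.card_wset_eq_one hD hS g hno hgc] at hlarge
          norm_num at hlarge
          linarith
        obtain ⟨x, y, hk⟩ := hun
        have hd := hD.2 g
        have hs := hS g
        have hlt := W.hacyc g
        simp only [hk] at hd hs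
        simp only [hk, Gk.preds, List.mem_cons, List.not_mem_nil, or_false] at hlt
        have hx := hlt x (Or.inl rfl)
        have hy := hlt y (Or.inr rfl)
        obtain ⟨e1, e2, e3, e4, e5⟩ := hd
        have key := ih (insert x (insert y (X.erase g)))
          (by
            intro h hh
            simp only [Finset.mem_insert] at hh
            rcases hh with rfl | rfl | hh
            · exact hgm ▸ hx
            · exact hgm ▸ hy
            · exact hne h hh)
          (by
            intro h hh
            simp only [Finset.mem_insert] at hh
            rw [e3] at hgS
            rcases hh with rfl | rfl | hh
            · exact ⟨⟨by omega, by omega⟩, Finset.union_subset_left hgS, fun a b => (hs a b).1⟩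
            · exact ⟨⟨by omega, by omega⟩, Finset.union_subset_right hgS, fun a b => (hs a b).2⟩
            · exact hX h (Finset.mem_of_mem_erase hh))
        have hbi : (insert x (insert y (X.erase g))).biUnion W.wset = X.biUnion W.wset := by
          conv_rhs => rw [← hXi]
          rw [Finset.biUnion_insert, Finset.biUnion_insert, Finset.biUnion_insert, e3,
            Finset.union_assoc]
        have hT : (((W.largeGates D s k S).filter fun h => h.val < m).card : ℝ) + 1 ≤
            ((W.largeGates D s k S).filter fun h => h.val < m + 1).card := by
          have hnot : g ∉ (W.largeGates D s k S).filter fun h => h.val < m := by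
            simp [hgm]
          rw [← Nat.cast_add_one, ← Finset.card_insert_of_notMem hnot]
          refine Nat.cast_le.2 (Finset.card_le_card ?_)
          intro h hh
          rcases Finset.mem_insert.1 hh with rfl | hh
          · exact Finset.mem_filter.2
              ⟨Finset.mem_filter.2 ⟨Finset.mem_univ _, hgK, hlarge, hgS⟩, by omega⟩
          · exact Finset.monotone_filter_right _ (fun h _ hh => Nat.lt_succ_of_lt hh) hh
        have hXc : ((insert x (insert y (X.erase g))).card : ℝ) ≤ (X.erase g).card + 2 := by
          have h2 := Finset.card_insert_le x (insert y (X.erase g))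
          have h3 := Finset.card_insert_le y (X.erase g)
          exact_mod_cast (by omega : _ ≤ (X.erase g).card + 2)
        rw [hbi] at key
        refine key.trans (mul_le_mul_of_nonneg_left ?_ (by linarith))
        linarith
      · have key := ih (X.erase g) hne fun h hh => hX h (Finset.mem_of_mem_erase hh)
        have hle : ((X.biUnion W.wset).card : ℝ) ≤
            (W.wset g).card + ((X.erase g).biUnion W.wset).card := by
          rw [← hXi, Finset.biUnion_insert, hXi]
          exact_mod_cast Finset.card_union_le _ _
        rw [not_le] at hlarge
        nlinarith
    · push Not at hmX
      refine (ih X (fun g hg => lt_of_le_of_ne (Nat.lt_succ_iff.1 (hXm g hg)) (hmX g hg))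
        hX).trans (mul_le_mul_of_nonneg_left ?_ (by linarith))
      linarith

/-- Computing a row set through union gates on a fixed interval, starting from single rows,
requires many gates with large row sets. -/
theorem WitnessCircuit.card_wset_le {nB nC : ℕ} {W : WitnessCircuit nB}
    (hD : W.Defined nC) (hS : W.Structured) {D : ℝ} (h1 : 1 < D) (g : Fin W.N)
    (hc : ∀ x y, W.kind g ≠ Gk.concat x y) :
    ((W.wset g).card : ℝ) ≤
      D * (1 + (W.largeGates D (W.st g) (W.ln g) (W.wset g)).card) := by
  have key := W.card_biUnion_wset_le hD hS h1 (W.st g) (W.ln g) (W.wset g) W.N {g}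
    (fun h _ => h.isLt) (by simpa using hc)
  simpa using key

/-- **Lemma (many partitions).**  Let `n` be sufficiently large and `G̃` tripartite with
`|A| = |C| = n`, `|B| = ⌊n/3⌋`, matrices `P̃, Q`.  Let `W` be a correct witness for
`P̃ × Q` and suppose each `a ∈ A` comes with distinct subintervals
`K_{a,1}, …, K_{a,ℓ_a}` covering `C` (given by starts `Ks a j` and lengths `Kl a j`) and
union gates `g_{a,j}` outputting `(Γ(a), K_{a,j}, ·)`.  Let `c, d ≥ 4`, `ℓ ≥ 1`,
`r ≥ 2d·log₂ n`, and let `L = {a : ℓ_a ≥ ℓ and |Γ(a)| ≥ r}`.  If the `A–B` graph of `G̃`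
is `(c·log₂ n, d·log₂ n)`-diverse, then `W` has at least
`r·ℓ·|L| / (2cd·(log₂ n)²)` gates. -/
theorem stmt10 :
    ∀ᶠ n : ℕ in Filter.atTop,
      ∀ (Pt : Fin n → Fin (n / 3) → Bool) (Q : Fin (n / 3) → Fin n → Bool)
        (W : WitnessCircuit (n / 3)), W.Correct n Pt →
      ∀ (la : Fin n → ℕ) (Ks Kl : (a : Fin n) → Fin (la a) → ℕ),
        (∀ a j, 1 ≤ Kl a j ∧ Ks a j + Kl a j ≤ n) →
        (∀ a, ∀ j j' : Fin (la a), j ≠ j' → (Ks a j, Kl a j) ≠ (Ks a j', Kl a j')) →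
        (∀ a, ∀ c : ℕ, c < n → ∃ j, Ks a j ≤ c ∧ c < Ks a j + Kl a j) →
        (∀ a j, ∃ (g x y : Fin W.N), W.kind g = Gk.union x y ∧
          W.wset g = (Finset.univ.filter fun b => Pt a b = true) ∧
          W.st g = Ks a j ∧ W.ln g = Kl a j) →
      ∀ (c d : ℕ), 4 ≤ c → 4 ≤ d → ∀ l r : ℕ, 1 ≤ l →
        2 * (d : ℝ) * Real.logb 2 n ≤ (r : ℝ) →
        Diverse Pt ((c : ℝ) * Real.logb 2 n) ((d : ℝ) * Real.logb 2 n) →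
        ((r : ℝ) * l * ((Finset.univ.filter fun a : Fin n =>
            l ≤ la a ∧ r ≤ (Finset.univ.filter fun b => Pt a b = true).card).card : ℝ)) /
          (2 * c * d * (Real.logb 2 n) ^ 2) ≤ (W.N : ℝ) := by
  filter_upwards [Filter.eventually_ge_atTop 2] with n hn
  intro Pt Q W hW la Ks Kl _ hdist _ hgate c d hc hd l r _ hr hdiv
  obtain ⟨hD, hS, -⟩ := hW
  have hlog : 1 ≤ Real.logb 2 n := by
    rw [Real.le_logb_iff_rpow_le (by norm_num) (by positivity)]
    simpa using (Nat.cast_le (α := ℝ)).2 hn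
  set t : ℝ := Real.logb 2 n
  set Γ : Fin n → Finset (Fin (n / 3)) := fun a => Finset.univ.filter fun b => Pt a b = true
    with hΓ
  set L : Finset (Fin n) := Finset.univ.filter fun a => l ≤ la a ∧ r ≤ (Γ a).card with hL
  have hc' : (4 : ℝ) ≤ c := by exact_mod_cast hc
  have hd' : (4 : ℝ) ≤ d := by exact_mod_cast hd
  have hdt : 1 < (d : ℝ) * t := by nlinarith
  let rel : Fin n → Fin W.N → Prop := fun a h =>
    (d : ℝ) * t ≤ ((W.wset h).card : ℝ) ∧ W.wset h ⊆ Γ a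
  have hupper : ∀ h, ((L.bipartiteBelow rel h).card : ℝ) ≤ c * t := by
    intro h
    by_cases hh : (d : ℝ) * t ≤ ((W.wset h).card : ℝ)
    · refine le_trans ?_ (hdiv (W.wset h) hh).le
      refine Nat.cast_le.2 (Finset.card_le_card fun a ha => ?_)
      have hsub := ((Finset.mem_bipartiteBelow _).1 ha).2.2
      refine Finset.mem_filter.2 ⟨Finset.mem_univ _, fun b hb => ?_⟩
      simpa [hΓ] using hsub hb
    · have he : L.bipartiteBelow rel h = ∅ :=
        Finset.filter_eq_empty_iff.2 fun a _ ha => hh ha.1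
      rw [he, Finset.card_empty, Nat.cast_zero]
      positivity
  have hlower : ∀ a ∈ L, (l : ℝ) * (r / (2 * (d * t))) ≤
      (((Finset.univ : Finset (Fin W.N)).bipartiteAbove rel a).card : ℝ) := by
    intro a ha
    obtain ⟨hla, hra⟩ := (Finset.mem_filter.1 ha).2
    have hra' : (r : ℝ) ≤ (Γ a).card := by exact_mod_cast hra
    have hone : ∀ j, (r : ℝ) / (2 * (d * t)) ≤
        (W.largeGates (d * t) (Ks a j) (Kl a j) (Γ a)).card := by
      intro j
      obtain ⟨g, x, y, hk, hw, hst, hln⟩ := hgate a j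
      have key := W.card_wset_le hD hS hdt g (by simp [hk])
      rw [hw, hst, hln] at key
      rw [div_le_iff₀ (by linarith)]
      linarith
    have hdisj : ((Finset.univ : Finset (Fin (la a))) : Set (Fin (la a))).PairwiseDisjoint
        fun j => W.largeGates (d * t) (Ks a j) (Kl a j) (Γ a) := by
      intro i _ j _ hij
      refine Finset.disjoint_left.2 fun h hi hj => hdist a i j hij ?_
      have h1 := (Finset.mem_filter.1 hi).2.1
      have h2 := (Finset.mem_filter.1 hj).2.1
      rw [← h1.1, ← h1.2, ← h2.1, ← h2.2]
    have hsub : (Finset.univ.biUnion fun j => W.largeGates (d * t) (Ks a j) (Kl a j) (Γ a)) ⊆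
        (Finset.univ : Finset (Fin W.N)).bipartiteAbove rel a := by
      intro h hh
      obtain ⟨j, -, hj⟩ := Finset.mem_biUnion.1 hh
      exact (Finset.mem_bipartiteAbove _).2 ⟨Finset.mem_univ _, (Finset.mem_filter.1 hj).2.2⟩
    have hcard := Finset.card_le_card hsub
    rw [Finset.card_biUnion hdisj] at hcard
    calc (l : ℝ) * (r / (2 * (d * t))) ≤ la a * (r / (2 * (d * t))) := by gcongr
      _ = ∑ _j : Fin (la a), (r : ℝ) / (2 * (d * t)) := by simp
      _ ≤ ∑ j, ((W.largeGates (d * t) (Ks a j) (Kl a j) (Γ a)).card : ℝ) :=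
        Finset.sum_le_sum fun j _ => hone j
      _ ≤ _ := by exact_mod_cast hcard
  have hcount : (L.card : ℝ) * (l * (r / (2 * (d * t)))) ≤ W.N * (c * t) := by
    calc (L.card : ℝ) * (l * (r / (2 * (d * t))))
        ≤ ∑ a ∈ L, (((Finset.univ : Finset (Fin W.N)).bipartiteAbove rel a).card : ℝ) := by
          rw [← nsmul_eq_mul]
          exact Finset.card_nsmul_le_sum _ _ _ hlower
      _ = ∑ h, ((L.bipartiteBelow rel h).card : ℝ) := by
          exact_mod_cast Finset.sum_card_bipartiteAbove_eq_sum_card_bipartiteBelow rel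
      _ ≤ W.N * (c * t) := by
          simpa using Finset.sum_le_card_nsmul Finset.univ _ _ fun h _ => hupper h
  rw [div_le_iff₀ (by positivity)]
  have hpos : 0 < 2 * (d * t) := by positivity
  calc (r : ℝ) * l * L.card = (L.card : ℝ) * (l * (r / (2 * (d * t)))) * (2 * (d * t)) := by
        field_simp
    _ ≤ W.N * (c * t) * (2 * (d * t)) := by gcongr
    _ = _ := by ring
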